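/- arXiv:1003.5649 — 6 statements merged into one kernel-verified Lean document; each statement's English description precedes it below -/
import Mathlib

section
/- Suppose that A ⊆ G := 𝔽₂ⁿ has density α > 1/2 − ε where ε ∈ (0, 1/(2⁹√n)]. Then A + A contains a subspace of co-dimension 1. -/
open Pointwise

/-- The group `𝔽₂ʳ` has exponent two. -/
lemma cube_add_self {r : ℕ} (x : Fin r → ZMod 2) : x + x = 0 :=
  funext fun i => CharTwo.add_self_eq_zero (x i)

/-- The Euclidean norm of a sum of plane vectors is at most the sum of their norms. -/
lemma sqrt_sum_sq_add_sum_sq_le {ι : Type*} (s : Finset ι) (u v : ι → ℝ) :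
    √((∑ i ∈ s, u i) ^ 2 + (∑ i ∈ s, v i) ^ 2) ≤ ∑ i ∈ s, √(u i ^ 2 + v i ^ 2) := by
  have h := norm_sum_le s (fun i => (⟨u i, v i⟩ : ℂ))
  simpa [Complex.norm_eq_sqrt_sq_add_sq] using h

/-- The sum of a function over the cube, split along the first coordinate. -/
lemma sum_cube_succ {r : ℕ} (g : (Fin (r + 1) → ZMod 2) → ℝ) :
    ∑ x, g x = ∑ x : Fin r → ZMod 2, g (Fin.cons 0 x) + ∑ x : Fin r → ZMod 2, g (Fin.cons 1 x) := by
  rw [← (Fin.consEquiv (fun _ => ZMod 2)).sum_comp, Fintype.sum_prod_type]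
  exact Fin.sum_univ_two (f := fun a : Fin 2 =>
    ∑ x : Fin r → ZMod 2, g (Fin.cons (α := fun _ => ZMod 2) a x))

/-- The squared length of the one-sided discrete gradient of `f` at `x`. -/
noncomputable def gradSq {r : ℕ} (f : (Fin r → ZMod 2) → ℝ) (x : Fin r → ZMod 2) : ℝ :=
  ∑ i, max (f x - f (x + Pi.single i 1)) 0 ^ 2

lemma gradSq_nonneg {r : ℕ} (f : (Fin r → ZMod 2) → ℝ) (x : Fin r → ZMod 2) : 0 ≤ gradSq f x :=
  Finset.sum_nonneg fun _ _ => sq_nonneg _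

lemma gradSq_cons {r : ℕ} (f : (Fin (r + 1) → ZMod 2) → ℝ) (a : ZMod 2) (x : Fin r → ZMod 2) :
    gradSq f (Fin.cons a x) = gradSq (fun y => f (Fin.cons a y)) x +
      max (f (Fin.cons a x) - f (Fin.cons (a + 1) x)) 0 ^ 2 := by
  have h₀ : (Fin.cons a x : Fin (r + 1) → ZMod 2) + Pi.single 0 1 = Fin.cons (a + 1) x := by
    ext j; refine Fin.cases ?_ (fun j => ?_) j <;> simp
  have h₁ (i : Fin r) : (Fin.cons a x : Fin (r + 1) → ZMod 2) + Pi.single i.succ 1 =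
      Fin.cons a (x + Pi.single i 1) := by
    ext j; refine Fin.cases ?_ (fun j => ?_) j <;> simp [Pi.single_apply]
  simp only [gradSq, Fin.sum_univ_succ, h₀, h₁]
  ring

/-- The two-point inequality driving the induction. -/
lemma two_point_le {a b u : ℝ} (ha₀ : 0 ≤ a) (ha₁ : a ≤ 1) (hb₀ : 0 ≤ b)
    (hu : a * (1 - a) ≤ u) :
    a * (1 - a) + max (a - b) 0 ^ 2 / 2 ≤ √(u ^ 2 + max (a - b) 0 ^ 2) := by
  have hp : 0 ≤ a * (1 - a) := mul_nonneg ha₀ (by linarith)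
  have hp' : a * (1 - a) ≤ 1 / 4 := by nlinarith [sq_nonneg (a - 1 / 2)]
  have hd₀ : 0 ≤ max (a - b) 0 := le_max_right _ _
  have hd₁ : max (a - b) 0 ≤ 1 := max_le (by linarith) zero_le_one
  set d := max (a - b) 0
  set p := a * (1 - a)
  apply Real.le_sqrt_of_sq_le
  have hd : d ^ 2 ≤ 1 := by nlinarith
  nlinarith [sq_nonneg d, mul_le_mul_of_nonneg_right hp' (sq_nonneg d),
    mul_le_mul_of_nonneg_right hd (sq_nonneg d)]

/-- A one-sided form of Talagrand's isoperimetric inequality on the discrete cube. -/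
theorem mean_mul_one_sub_mean_le_sum_sqrt_gradSq (r : ℕ) (f : (Fin r → ZMod 2) → ℝ)
    (hf : ∀ x, f x = 0 ∨ f x = 1) :
    (∑ x, f x) / 2 ^ r * (1 - (∑ x, f x) / 2 ^ r) ≤ (∑ x, √(gradSq f x)) / 2 ^ r := by
  induction r with
  | zero =>
    have h (x) : f x * (1 - f x) = 0 := by
      rcases hf x with h | h <;> simp [h]
    simpa [gradSq] using (h _).le
  | succ r ih =>
    have mean_mem (c : ZMod 2) : 0 ≤ (∑ x : Fin r → ZMod 2, f (Fin.cons c x)) / 2 ^ r ∧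
        (∑ x : Fin r → ZMod 2, f (Fin.cons c x)) / 2 ^ r ≤ 1 := by
      constructor
      · refine div_nonneg (Finset.sum_nonneg fun x _ => ?_) (by positivity)
        rcases hf (Fin.cons c x) with h | h <;> simp [h]
      · rw [div_le_one (by positivity)]
        calc _ ≤ ∑ x : Fin r → ZMod 2, (1 : ℝ) := Finset.sum_le_sum fun x _ => by
              rcases hf (Fin.cons c x) with h | h <;> simp [h]
          _ = 2 ^ r := by simp
    have slice (c : ZMod 2) (a b : ℝ) (ha : (∑ x : Fin r → ZMod 2, f (Fin.cons c x)) / 2 ^ r = a)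
        (hb : (∑ x : Fin r → ZMod 2, f (Fin.cons (c + 1) x)) / 2 ^ r = b) :
        a * (1 - a) + max (a - b) 0 ^ 2 / 2 ≤
          (∑ x : Fin r → ZMod 2, √(gradSq f (Fin.cons c x))) / 2 ^ r := by
      have hu := ih (fun x => f (Fin.cons c x)) fun x => hf _
      have hma := mean_mem c
      have hmb := mean_mem (c + 1)
      rw [ha] at hma hu
      rw [hb] at hmb
      refine (two_point_le hma.1 hma.2 hmb.1 hu).trans ?_
      have hpow : (0 : ℝ) < 2 ^ r := by positivity
      rw [le_div_iff₀ hpow]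
      simp only [gradSq_cons]
      have hmax : max (a - b) 0 * 2 ^ r ≤
          ∑ x : Fin r → ZMod 2, max (f (Fin.cons c x) - f (Fin.cons (c + 1) x)) 0 := by
        rw [max_mul_of_nonneg _ _ hpow.le]
        refine max_le ?_ (by rw [zero_mul]; exact Finset.sum_nonneg fun _ _ => le_max_right _ _)
        rw [← ha, ← hb, sub_mul, div_mul_cancel₀ _ hpow.ne', div_mul_cancel₀ _ hpow.ne',
          ← Finset.sum_sub_distrib]
        exact Finset.sum_le_sum fun _ _ => le_max_left _ _
      have hmink := sqrt_sum_sq_add_sum_sq_le Finset.univ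
        (fun x : Fin r → ZMod 2 => √(gradSq (fun y => f (Fin.cons c y)) x))
        (fun x => max (f (Fin.cons c x) - f (Fin.cons (c + 1) x)) 0)
      simp only [Real.sq_sqrt (gradSq_nonneg _ _)] at hmink
      refine le_trans ?_ hmink
      apply Real.le_sqrt_of_sq_le
      rw [mul_pow, Real.sq_sqrt (by positivity), add_mul, ← mul_pow, ← mul_pow,
        div_mul_cancel₀ _ hpow.ne']
      gcongr
    have h₀ := slice 0 _ _ rfl rfl
    have h₁ := slice 1 _ _ rfl rfl
    have h01 : (0 + 1 : ZMod 2) = 1 := rfl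
    have h10 : (1 + 1 : ZMod 2) = 0 := rfl
    rw [h01] at h₀
    rw [h10] at h₁
    rw [sum_cube_succ f, sum_cube_succ (fun x => √(gradSq f x)), pow_succ,
      ← div_div, ← div_div, add_div, add_div _ _ ((2 : ℝ) ^ r)]
    generalize (∑ x : Fin r → ZMod 2, f (Fin.cons 0 x)) / 2 ^ r = a at *
    generalize (∑ x : Fin r → ZMod 2, f (Fin.cons 1 x)) / 2 ^ r = b at *
    have hab : max (a - b) 0 ^ 2 + max (b - a) 0 ^ 2 = (a - b) ^ 2 := by
      rcases le_total a b with h | h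
      · rw [max_eq_right (by linarith), max_eq_left (by linarith)]; ring
      · rw [max_eq_left (by linarith), max_eq_right (by linarith)]; ring
    nlinarith

/-- If `P` and `Q` are sets in the cube such that `Q` avoids the closed neighbourhood of `P`, then
their densities fall short of `1` by the order of `1 / √r`. -/
theorem card_add_card_le_of_disjoint_neighbours {r : ℕ} (P Q : Finset (Fin r → ZMod 2))
    (h₀ : Disjoint P Q) (h₁ : ∀ x ∈ P, ∀ i, x + Pi.single i 1 ∉ Q) :
    (P.card : ℝ) / 2 ^ r * (1 - P.card / 2 ^ r) ≤ √r * (1 - P.card / 2 ^ r - Q.card / 2 ^ r) := by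
  classical
  have hpow : (0 : ℝ) < 2 ^ r := by positivity
  set f : (Fin r → ZMod 2) → ℝ := fun x => if x ∈ P then 0 else 1 with hf
  have hsum : ∑ x, f x = 2 ^ r - P.card := by
    have h (x : Fin r → ZMod 2) : f x = 1 - if x ∈ P then 1 else 0 := by
      simp only [hf]; split_ifs <;> norm_num
    simp [h]
  have hiso := mean_mul_one_sub_mean_le_sum_sqrt_gradSq r f fun x => by
    simp only [hf]; split_ifs <;> simp
  have hbound (x : Fin r → ZMod 2) : √(gradSq f x) ≤
      √r * (1 - (if x ∈ P then 1 else 0) - if x ∈ Q then 1 else 0) := by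
    have zero_of (h : ∀ i, f x ≤ f (x + Pi.single i 1)) : √(gradSq f x) = 0 := by
      have : gradSq f x = 0 := Finset.sum_eq_zero fun i _ => by
        rw [max_eq_right (sub_nonpos.2 (h i))]; simp
      rw [this, Real.sqrt_zero]
    by_cases hP : x ∈ P
    · have hQ : x ∉ Q := Finset.disjoint_left.1 h₀ hP
      rw [zero_of fun i => by simp only [hf, hP, if_true]; split_ifs <;> norm_num]
      simp [hP, hQ]
    · by_cases hQ : x ∈ Q
      · rw [zero_of fun i => ?_]
        · simp [hP, hQ]
        · have : x + Pi.single i 1 ∉ P := fun h => h₁ _ h i (by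
            rwa [add_assoc, cube_add_self, add_zero])
          simp [hf, hP, this]
      · simp only [hP, hQ, if_false, sub_zero, mul_one]
        apply Real.sqrt_le_sqrt
        calc gradSq f x ≤ ∑ _i : Fin r, (1 : ℝ) := Finset.sum_le_sum fun i _ => by
              simp only [hf]; split_ifs <;> norm_num
          _ = r := by simp
  have htotal := Finset.sum_le_sum fun x (_ : x ∈ (Finset.univ : Finset (Fin r → ZMod 2))) => hbound x
  rw [← Finset.mul_sum] at htotal
  simp only [Finset.sum_sub_distrib, Finset.sum_boole, Finset.filter_mem_eq_inter,
    Finset.univ_inter, Finset.sum_const, Finset.card_univ, Fintype.card_fun, ZMod.card,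
    Fintype.card_fin, nsmul_eq_mul, mul_one] at htotal
  push_cast at htotal
  rw [hsum, sub_div, div_self hpow.ne'] at hiso
  calc _ = (1 - (P.card : ℝ) / 2 ^ r) * (1 - (1 - P.card / 2 ^ r)) := by ring
    _ ≤ _ := hiso
    _ ≤ √r * (2 ^ r - P.card - Q.card) / 2 ^ r := by gcongr
    _ = _ := by field_simp

/-- A set disjoint from its translate has density at most `1 / 2`. -/
lemma card_le_of_add_notMem {r : ℕ} (P : Finset (Fin r → ZMod 2)) (w : Fin r → ZMod 2)
    (h : ∀ x ∈ P, x + w ∉ P) : (P.card : ℝ) / 2 ^ r ≤ 1 / 2 := by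
  classical
  have hd : Disjoint P (P.map (addRightEmbedding w)) := by
    rw [Finset.disjoint_left]
    intro x hx hx'
    obtain ⟨y, hy, rfl⟩ := Finset.mem_map.1 hx'
    exact h y hy hx
  have hc := Finset.card_le_univ (P ∪ P.map (addRightEmbedding w))
  rw [Finset.card_union_of_disjoint hd, Finset.card_map] at hc
  simp only [Fintype.card_fun, ZMod.card, Fintype.card_fin] at hc
  have : (P.card : ℝ) + P.card ≤ 2 ^ r := by exact_mod_cast hc
  rw [div_le_div_iff₀ (by positivity) (by norm_num)]
  linarith

/-- If every linear functional vanishes somewhere on `S ⊆ 𝔽₂ⁿ`, then `S` contains at most `n + 1`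
elements, odd in number, with sum zero. -/
theorem exists_odd_card_sum_eq_zero {n : ℕ} (S : Set (Fin n → ZMod 2))
    (hS : ∀ g : Module.Dual (ZMod 2) (Fin n → ZMod 2), ∃ s ∈ S, g s = 0) :
    ∃ F : Finset (Fin n → ZMod 2), (F : Set (Fin n → ZMod 2)) ⊆ S ∧ Odd F.card ∧
      F.card ≤ n + 1 ∧ ∑ s ∈ F, s = 0 := by
  classical
  let lift : (Fin n → ZMod 2) → (Fin n → ZMod 2) × ZMod 2 := fun s => (s, 1)
  have hmem : ((0, 1) : (Fin n → ZMod 2) × ZMod 2) ∈ Submodule.span (ZMod 2) (lift '' S) := by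
    by_contra hnot
    obtain ⟨f, hf, hker⟩ := Submodule.exists_le_ker_of_notMem hnot
    obtain ⟨s, hs, hgs⟩ := hS (f ∘ₗ LinearMap.inl (ZMod 2) _ _)
    have h₁ : f (lift s) = 0 := hker (Submodule.subset_span ⟨s, hs, rfl⟩)
    have h₂ : lift s = (s, 0) + (0, 1) := by simp [lift]
    rw [h₂, map_add] at h₁
    simp only [LinearMap.comp_apply, LinearMap.inl_apply] at hgs
    rw [hgs, zero_add] at h₁
    exact hf h₁
  obtain ⟨b, hb, hspan, hind⟩ := exists_linearIndependent (ZMod 2) (lift '' S)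
  rw [← hspan] at hmem
  obtain ⟨c, t, htb, -, hsum⟩ := Submodule.mem_span_iff_exists_finset_subset.1 hmem
  set T := t.filter fun x => c x ≠ 0 with hT
  have hTb : (T : Set ((Fin n → ZMod 2) × ZMod 2)) ⊆ b := fun x hx =>
    htb (Finset.filter_subset _ _ hx)
  have hTsum : ∑ x ∈ T, x = (0, 1) := by
    rw [← hsum, hT, Finset.sum_filter]
    refine Finset.sum_congr rfl fun x _ => ?_
    split_ifs with h
    · have h1 : c x = 1 := by
        generalize c x = a at *
        revert a; decide
      rw [h1, one_smul]
    · rw [not_not.1 h, zero_smul]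
  have hTcard : T.card ≤ n + 1 := by
    have hli : LinearIndependent (ZMod 2) ((↑) : T → (Fin n → ZMod 2) × ZMod 2) := LinearIndepOn.mono (v := id) hind hTb
    simpa using hli.fintype_card_le_finrank
  have hsnd (x) (hx : x ∈ T) : x.2 = 1 := by
    obtain ⟨s, -, rfl⟩ := hb (hTb hx); rfl
  have hinj : Set.InjOn Prod.fst (T : Set ((Fin n → ZMod 2) × ZMod 2)) := fun x hx y hy hxy =>
    Prod.ext hxy ((hsnd x hx).trans (hsnd y hy).symm)
  refine ⟨T.image Prod.fst, ?_, ?_, ?_, ?_⟩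
  · intro s hs
    obtain ⟨x, hx, rfl⟩ := Finset.mem_image.1 (Finset.mem_coe.1 hs)
    obtain ⟨s, hsS, rfl⟩ := hb (hTb hx)
    exact hsS
  · rw [Finset.card_image_of_injOn hinj, ← ZMod.natCast_eq_one_iff_odd]
    have h := congrArg Prod.snd hTsum
    rw [Prod.snd_sum, Finset.sum_congr rfl hsnd] at h
    simpa using h
  · rwa [Finset.card_image_of_injOn hinj]
  · rw [Finset.sum_image hinj, ← Prod.fst_sum, hTsum]

/-- A set whose sumset misses an odd number `r + 2` of vectors with sum zero has density at most
`1 / 2 - c / √r`. -/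
theorem density_le_of_notMem_add {n r : ℕ} (A : Finset (Fin n → ZMod 2))
    (s : Fin r → Fin n → ZMod 2) (p q : Fin n → ZMod 2) (hr : Odd r)
    (hsum : p + (q + ∑ i, s i) = 0) (hp : p ∉ A + A) (hq : q ∉ A + A) (hs : ∀ i, s i ∉ A + A) :
    (A.card : ℝ) / 2 ^ n ≤ 1 / 2 - 1 / (16 * √r) := by
  classical
  have hr₁ : (1 : ℝ) ≤ √r := by
    rw [Real.one_le_sqrt]; exact_mod_cast hr.pos
  have avoid {t x : Fin n → ZMod 2} (ht : t ∉ A + A) (hx : x ∈ A) : x + t ∉ A := fun h =>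
    ht (Finset.mem_add.2 ⟨x, hx, x + t, h, by
      rw [← add_assoc, cube_add_self, zero_add]⟩)
  let L : (Fin r → ZMod 2) →ₗ[ZMod 2] (Fin n → ZMod 2) :=
    Fintype.linearCombination (ZMod 2) fun i => s i + p
  have hL (i : Fin r) : L (Pi.single i 1) = s i + p := by
    simp [L, Fintype.linearCombination_apply_single]
  have hL₁ : L 1 = q := by
    have h₁ : L 1 = ∑ i, s i + p := by
      simp only [L, Fintype.linearCombination_apply, Pi.one_apply, one_smul,
        Finset.sum_add_distrib, Finset.sum_const, Finset.card_univ, Fintype.card_fin]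
      rw [← Nat.cast_smul_eq_nsmul (ZMod 2), ZMod.natCast_eq_one_iff_odd.2 hr, one_smul]
    calc L 1 = L 1 + (q + q) := by rw [cube_add_self, add_zero]
      _ = p + (q + ∑ i, s i) + q := by rw [h₁]; abel
      _ = q := by rw [hsum, zero_add]
  let P (x : Fin n → ZMod 2) : Finset (Fin r → ZMod 2) := Finset.univ.filter fun v => x + L v ∈ A
  have hhalf (x) : ((P x).card : ℝ) / 2 ^ r ≤ 1 / 2 := by
    refine card_le_of_add_notMem _ 1 fun v hv => ?_
    simp only [P, Finset.mem_filter, Finset.mem_univ, true_and] at hv ⊢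
    rw [map_add, hL₁, ← add_assoc]
    exact avoid hq hv
  have hcard (x) : ∑ y, ((P (y + x)).card : ℝ) = 2 ^ r * A.card := by
    have h (v : Fin r → ZMod 2) :
        ∑ y, (if y + x + L v ∈ A then 1 else 0 : ℝ) = A.card := by
      have := Equiv.sum_comp (Equiv.addRight (x + L v)) (fun y => if y ∈ A then (1 : ℝ) else 0)
      simpa [add_assoc] using this
    calc _ = ∑ y, ∑ v, (if y + x + L v ∈ A then 1 else 0 : ℝ) := by simp [P]
      _ = _ := by rw [Finset.sum_comm]; simp [h]
  obtain ⟨x, -, hx⟩ : ∃ x ∈ (Finset.univ : Finset (Fin n → ZMod 2)),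
      2 * ((A.card : ℝ) / 2 ^ n) ≤ (P x).card / 2 ^ r + (P (x + p)).card / 2 ^ r := by
    apply Finset.exists_le_of_sum_le Finset.univ_nonempty
    have h0 := hcard 0
    simp only [add_zero] at h0
    rw [Finset.sum_add_distrib, ← Finset.sum_div, ← Finset.sum_div, hcard p, h0]
    simp only [Finset.sum_const, Finset.card_univ, Fintype.card_fun, ZMod.card, Fintype.card_fin,
      nsmul_eq_mul]
    push_cast
    apply le_of_eq
    field_simp
    ring
  have hP := hhalf x
  have hQ := hhalf (x + p)
  have hiso := card_add_card_le_of_disjoint_neighbours (P x) (P (x + p))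
    (by
      rw [Finset.disjoint_left]
      intro v hv
      simp only [P, Finset.mem_filter, Finset.mem_univ, true_and] at hv ⊢
      rw [add_right_comm]
      exact avoid hp hv)
    (by
      intro v hv i
      simp only [P, Finset.mem_filter, Finset.mem_univ, true_and] at hv ⊢
      have : x + p + L (v + Pi.single i 1) = x + L v + s i := by
        rw [map_add, hL]
        calc _ = x + L v + s i + (p + p) := by abel
          _ = _ := by rw [cube_add_self, add_zero]
      rw [this]
      exact avoid (hs i) hv)
  generalize ((P x).card : ℝ) / 2 ^ r = a at *
  generalize ((P (x + p)).card : ℝ) / 2 ^ r = b at *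
  by_contra! hlt
  have hinv : 1 / (16 * √r) * √r = 1 / 16 := by field_simp
  have hsmall : 1 / (16 * √r) ≤ 1 / 16 := by
    apply one_div_le_one_div_of_le <;> linarith
  have ha : 3 / 8 < a := by linarith
  have hgap : 1 - a - b < 2 * (1 / (16 * √r)) := by linarith
  have : √r * (1 - a - b) < 1 / 8 := by
    calc _ < √r * (2 * (1 / (16 * √r))) := by gcongr
      _ = 1 / 8 := by linarith
  nlinarith

/-- If `A ⊆ 𝔽₂ⁿ` has density `> 1/2 - ε` with `ε ∈ (0, 1/(2⁹√n)]`, then `A + A`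
contains a subspace of co-dimension `1`. -/
theorem sumset_contains_codim_one_subspace {n : ℕ} (A : Finset (Fin n → ZMod 2)) (ε : ℝ)
    (hε₀ : 0 < ε) (hε₁ : ε ≤ 1 / (2 ^ 9 * Real.sqrt n))
    (hA : (A.card : ℝ) / 2 ^ n > 1 / 2 - ε) :
    ∃ V : Submodule (ZMod 2) (Fin n → ZMod 2),
      Module.finrank (ZMod 2) V = n - 1 ∧
      (V : Set (Fin n → ZMod 2)) ⊆ ((A + A : Finset (Fin n → ZMod 2)) : Set (Fin n → ZMod 2)) := by
  have hn : 0 < n := by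
    rcases Nat.eq_zero_or_pos n with rfl | h
    · simp at hε₁; linarith
    · exact h
  have hsqrt : (1 : ℝ) ≤ √n := by
    rw [Real.one_le_sqrt]; exact_mod_cast hn
  have hε : ε ≤ 1 / 2 ^ 9 := hε₁.trans (one_div_le_one_div_of_le (by norm_num) (by linarith))
  by_contra hcon
  have finrank_ker (g : Module.Dual (ZMod 2) (Fin n → ZMod 2)) (hg : g ≠ 0) :
      Module.finrank (ZMod 2) (LinearMap.ker g) = n - 1 := by
    have h := Module.Dual.finrank_ker_add_one_of_ne_zero hg
    rw [Module.finrank_fin_fun] at h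
    omega
  have exists_zero (g : Module.Dual (ZMod 2) (Fin n → ZMod 2)) (hg : g ≠ 0) :
      ∃ s ∈ {s | s ∉ A + A}, g s = 0 := by
    by_contra! h
    exact hcon ⟨LinearMap.ker g, finrank_ker g hg, fun x hx => by
      by_contra hx'
      exact h x hx' hx⟩
  obtain ⟨F, hF, hodd, hle, hsum⟩ := exists_odd_card_sum_eq_zero {s | s ∉ A + A} fun g => by
    by_cases hg : g = 0
    · obtain ⟨s, hs, -⟩ := exists_zero (LinearMap.proj ⟨0, hn⟩) fun h => by
        simpa using LinearMap.congr_fun h (Pi.single ⟨0, hn⟩ 1)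
      exact ⟨s, hs, by simp [hg]⟩
    · exact exists_zero g hg
  have hne : A.Nonempty := by
    rw [Finset.nonempty_iff_ne_empty]
    rintro rfl
    simp at hA
    linarith
  have hzero : (0 : Fin n → ZMod 2) ∈ A + A := by
    obtain ⟨a, ha⟩ := hne
    exact Finset.mem_add.2 ⟨a, ha, a, ha, cube_add_self a⟩
  have hcard : F.card ≠ 1 := fun h => by
    obtain ⟨a, rfl⟩ := Finset.card_eq_one.1 h
    rw [Finset.sum_singleton] at hsum
    exact hF (Finset.mem_coe.2 (Finset.mem_singleton_self a)) (hsum ▸ hzero)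
  obtain ⟨r, hr⟩ : ∃ r, F.card = r + 2 := ⟨F.card - 2, by have := hodd.pos; omega⟩
  have hrodd : Odd r := by
    rw [hr] at hodd
    simpa [Nat.odd_add] using hodd
  let e := F.equivFinOfCardEq hr
  have he (i) : (e.symm i : Fin n → ZMod 2) ∉ A + A := hF (e.symm i).2
  rw [← Finset.sum_coe_sort, ← e.symm.sum_comp, Fin.sum_univ_succ, Fin.sum_univ_succ] at hsum
  have hdens := density_le_of_notMem_add A (fun i => e.symm i.succ.succ) _ _ hrodd hsum
    (he _) (he _) (fun i => he _)
  have hr₀ : 0 < √(r : ℝ) := Real.sqrt_pos.2 (by exact_mod_cast hrodd.pos)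
  have hrn : √(r : ℝ) ≤ √n := Real.sqrt_le_sqrt (by exact_mod_cast (by omega : r ≤ n))
  have : 1 / (2 ^ 9 * √(n : ℝ)) ≤ 1 / (16 * √r) :=
    one_div_le_one_div_of_le (by positivity) (by linarith)
  linarith
end

section
/- There is an absolute constant c > 0 such that for every n and every ε ∈ (4/√n, 1/2], there is a set A = A(ε) ⊆ G := 𝔽₂ⁿ of density α > 1/2 − ε such that any subspace contained in A + A has co-dimension at least c·ε·√n. -/
open Pointwise

/-- The central binomial coefficient bound `C(2k, k) ≤ 4 ^ k / √(2k + 1)`, squared. -/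
theorem two_mul_add_one_mul_centralBinom_sq_le (k : ℕ) :
    (2 * k + 1) * k.centralBinom ^ 2 ≤ 16 ^ k := by
  induction k with
  | zero => simp
  | succ k ih =>
    have h := Nat.succ_mul_centralBinom_succ k
    refine le_of_mul_le_mul_left (a := (k + 1) ^ 2) ?_ (by positivity)
    calc (k + 1) ^ 2 * ((2 * (k + 1) + 1) * (k + 1).centralBinom ^ 2)
        = (2 * k + 3) * ((k + 1) * (k + 1).centralBinom) ^ 2 := by ring
      _ = 4 * ((2 * k + 3) * (2 * k + 1)) * ((2 * k + 1) * k.centralBinom ^ 2) := by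
        rw [h]; ring
      _ ≤ 4 * (4 * (k + 1) ^ 2) * 16 ^ k := by
        exact Nat.mul_le_mul (Nat.mul_le_mul_left 4 (by nlinarith)) ih
      _ = (k + 1) ^ 2 * 16 ^ (k + 1) := by ring

/-- The middle binomial coefficient satisfies `C(n, ⌊n/2⌋) ≤ 2 ^ n / √n`, squared. -/
theorem mul_choose_half_sq_le (n : ℕ) : n * n.choose (n / 2) ^ 2 ≤ 4 ^ n := by
  obtain ⟨k, rfl | rfl⟩ := Nat.even_or_odd' n
  · have h := two_mul_add_one_mul_centralBinom_sq_le k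
    rw [Nat.centralBinom_eq_two_mul_choose] at h
    rw [Nat.mul_div_cancel_left k two_pos, pow_mul]
    norm_num
    nlinarith
  · have h := two_mul_add_one_mul_centralBinom_sq_le (k + 1)
    have hc : (k + 1).centralBinom = 2 * (2 * k + 1).choose k := by
      rw [Nat.centralBinom_eq_two_mul_choose, show 2 * (k + 1) = 2 * k + 1 + 1 by ring,
        Nat.choose_succ_succ, Nat.choose_symm_half]
      ring
    rw [hc, pow_succ 16] at h
    rw [show (2 * k + 1) / 2 = k by omega, pow_succ 4, pow_mul]
    norm_num
    nlinarith

/-- All but at most `s * C(n, ⌊n/2⌋)` of the subsets of an `n`-element set have size at distance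
at least `s / 2` from `n / 2`, and half of those are small. -/
theorem two_pow_le_two_mul_card_filter_add {n s : ℕ} (hs : s ≤ n) :
    2 ^ n ≤ 2 * (Finset.univ.filter fun S : Finset (Fin n) => 2 * S.card + s ≤ n).card
      + s * n.choose (n / 2) := by
  set low := Finset.univ.filter fun S : Finset (Fin n) => 2 * S.card + s ≤ n with hlow
  set high := Finset.univ.filter fun S : Finset (Fin n) => n + s ≤ 2 * S.card with hhigh
  set a := (n - s) / 2 + 1 with ha
  set mid := (Finset.Ico a (a + s)).biUnion
    fun k => Finset.powersetCard k (Finset.univ : Finset (Fin n)) with hmid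
  have hcard : high.card = low.card := by
    refine Finset.card_bij' (fun S _ => Sᶜ) (fun S _ => Sᶜ) ?_ ?_ (by simp) (by simp)
    all_goals
      intro S hS
      have := S.card_le_univ
      simp only [hlow, hhigh, Finset.mem_filter, Finset.mem_univ, true_and, Finset.card_compl,
        Fintype.card_fin] at hS this ⊢
      omega
  have hmidcard : mid.card ≤ s * n.choose (n / 2) := by
    refine (Finset.card_biUnion_le_card_mul _ _ (n.choose (n / 2)) fun k _ => ?_).trans ?_
    · simpa using Nat.choose_le_middle k n
    · simp
  have hcover : (Finset.univ : Finset (Finset (Fin n))) ⊆ low ∪ high ∪ mid := by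
    intro S _
    simp only [hlow, hhigh, hmid, Finset.mem_union, Finset.mem_filter, Finset.mem_univ, true_and,
      Finset.mem_biUnion, Finset.mem_Ico, Finset.mem_powersetCard, Finset.subset_univ]
    by_contra! hcon
    exact hcon.2 S.card (by omega) rfl
  have h := Finset.card_le_card hcover
  have h₁ := Finset.card_union_le (low ∪ high) mid
  have h₂ := Finset.card_union_le low high
  simp only [Finset.card_univ, Fintype.card_finset, Fintype.card_fin] at h
  omega

/-- Vectors over `𝔽₂` of a given weight range correspond to their supports. -/
theorem card_filter_hammingNorm (n : ℕ) (p : ℕ → Prop) [DecidablePred p] :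
    (Finset.univ.filter fun x : Fin n → ZMod 2 => p (hammingNorm x)).card =
      (Finset.univ.filter fun S : Finset (Fin n) => p S.card).card := by
  refine Finset.card_bij' (fun x _ => Finset.univ.filter fun i => x i ≠ 0)
    (fun S _ i => if i ∈ S then 1 else 0) ?_ ?_ ?_ ?_
  · intro x hx
    simpa [hammingNorm] using hx
  · intro S hS
    simpa [hammingNorm] using hS
  · intro x _
    funext i
    have : ∀ a : ZMod 2, (if a ≠ 0 then (1 : ZMod 2) else 0) = a := by decide
    simpa using this (x i)
  · intro S _
    ext i
    simp

theorem hammingNorm_add_le_add {ι : Type*} {β : ι → Type*} [Fintype ι]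
    [∀ i, DecidableEq (β i)] [∀ i, AddGroup (β i)] (x y : ∀ i, β i) :
    hammingNorm (x + y) ≤ hammingNorm x + hammingNorm y := by
  classical
  refine (Finset.card_le_card fun i => ?_).trans (Finset.card_union_le _ _)
  simp only [Finset.mem_filter, Finset.mem_univ, true_and, Finset.mem_union, Pi.add_apply]
  contrapose!
  rintro ⟨hx, hy⟩
  rw [hx, hy, add_zero]

/-- Every subspace contains a vector whose weight is at least the dimension. -/
theorem Submodule.exists_finrank_le_hammingNorm {K ι : Type*} [Field K] [DecidableEq K]
    [Fintype ι] (V : Submodule K (ι → K)) :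
    ∃ v ∈ V, Module.finrank K V ≤ hammingNorm v := by
  classical
  obtain ⟨m, ⟨v, hv, rfl⟩, hmax⟩ := ((Set.finite_Iic (Fintype.card ι)).subset
    (show hammingNorm '' (V : Set (ι → K)) ⊆ _ by rintro _ ⟨x, -, rfl⟩; exact hammingNorm_le_card_fintype)).exists_maximal
      ⟨_, 0, V.zero_mem, rfl⟩
  refine ⟨v, hv, ?_⟩
  let f : V →ₗ[K] ({i // v i ≠ 0} → K) :=
    (LinearMap.funLeft K K (Subtype.val : {i // v i ≠ 0} → ι)).comp V.subtype
  have hf : Function.Injective f := by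
    rw [injective_iff_map_eq_zero]
    rintro ⟨u, hu⟩ hfu
    have hu0 : ∀ i, v i ≠ 0 → u i = 0 := fun i hi => congrFun hfu ⟨i, hi⟩
    by_contra hne
    obtain ⟨j, hj⟩ : ∃ j, u j ≠ 0 := by
      by_contra! h
      exact hne (Subtype.ext (funext h))
    have hlt : hammingNorm v < hammingNorm (v + u) := by
      refine Finset.card_lt_card (Finset.ssubset_iff_of_subset ?_ |>.2 ⟨j, ?_, ?_⟩)
      · intro i hi
        simp only [Finset.mem_filter, Finset.mem_univ, true_and] at hi ⊢
        simpa [hu0 i hi] using hi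
      · have : v j = 0 := by
          by_contra h
          exact hj (hu0 j h)
        simpa [this] using hj
      · simp only [Finset.mem_filter, Finset.mem_univ, true_and]
        exact fun h => hj (hu0 j h)
    exact absurd (hmax ⟨v + u, V.add_mem hv hu, rfl⟩ hlt.le) (not_le.2 hlt)
  have := LinearMap.finrank_le_finrank_of_injective hf
  rwa [Module.finrank_fintype_fun_eq_card, Fintype.card_subtype] at this

/-- (Green–Ruzsa) There is `c > 0` such that for every `n` and every
`ε ∈ (4/√n, 1/2]` there is `A ⊆ 𝔽₂ⁿ` of density `> 1/2 - ε` such that any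
subspace contained in `A + A` has co-dimension at least `c ε √n`. -/
theorem exists_set_all_subspaces_large_codim :
    ∃ c : ℝ, 0 < c ∧ ∀ (n : ℕ) (ε : ℝ), 4 / Real.sqrt n < ε → ε ≤ 1 / 2 →
      ∃ A : Finset (Fin n → ZMod 2),
        (A.card : ℝ) / 2 ^ n > 1 / 2 - ε ∧
        ∀ V : Submodule (ZMod 2) (Fin n → ZMod 2),
          (V : Set (Fin n → ZMod 2)) ⊆ ((A + A : Finset (Fin n → ZMod 2)) : Set (Fin n → ZMod 2)) →
          c * ε * Real.sqrt n ≤ (n : ℝ) - (Module.finrank (ZMod 2) V : ℝ) := by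
  refine ⟨1 / 2, by norm_num, fun n ε hε hε' => ?_⟩
  rcases Nat.eq_zero_or_pos n with rfl | hn
  · have hε0 : 0 < ε := by simpa using hε
    refine ⟨Finset.univ, by simp; linarith, fun V _ => ?_⟩
    have := V.finrank_le
    simp_all
  set r := Real.sqrt n with hr
  have hr0 : 0 < r := Real.sqrt_pos.2 (by exact_mod_cast hn)
  have hrr : r * r = n := Real.mul_self_sqrt (Nat.cast_nonneg n)
  have hεr : 4 < ε * r := (div_lt_iff₀ hr0).1 hε
  set s := ⌊ε * r⌋₊ with hs
  have hsle : (s : ℝ) ≤ ε * r := Nat.floor_le (by linarith)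
  have hslt : ε * r < s + 1 := Nat.lt_floor_add_one _
  have hsn : s ≤ n := by
    have : (s : ℝ) ≤ n := by nlinarith
    exact_mod_cast this
  refine ⟨Finset.univ.filter fun x => 2 * hammingNorm x + s ≤ n, ?_, fun V hV => ?_⟩
  · rw [card_filter_hammingNorm n fun k => 2 * k + s ≤ n]
    have hcount : (2 : ℝ) ^ n ≤
        2 * ((Finset.univ.filter fun S : Finset (Fin n) => 2 * S.card + s ≤ n).card : ℝ)
          + s * (n.choose (n / 2) : ℝ) := by
      exact_mod_cast two_pow_le_two_mul_card_filter_add hsn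
    have hchoose : r * (n.choose (n / 2) : ℝ) ≤ 2 ^ n := by
      refine (sq_le_sq₀ (by positivity) (by positivity)).1 ?_
      have h : (n : ℝ) * (n.choose (n / 2) : ℝ) ^ 2 ≤ 4 ^ n := by
        exact_mod_cast mul_choose_half_sq_le n
      rw [mul_pow, sq r, hrr, ← pow_mul, mul_comm n 2, pow_mul]
      norm_num
      exact h
    have hε0 : 0 < ε := pos_of_mul_pos_left (by linarith) hr0.le
    have hmid : (s : ℝ) * (n.choose (n / 2) : ℝ) ≤ ε * 2 ^ n :=
      calc (s : ℝ) * (n.choose (n / 2) : ℝ) ≤ ε * r * (n.choose (n / 2) : ℝ) := by gcongr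
        _ = ε * (r * (n.choose (n / 2) : ℝ)) := by ring
        _ ≤ ε * 2 ^ n := by gcongr
    have h2 : (0 : ℝ) < ε * 2 ^ n := by positivity
    rw [gt_iff_lt, lt_div_iff₀ (by positivity)]
    linarith
  · obtain ⟨v, hv, hdim⟩ := V.exists_finrank_le_hammingNorm
    obtain ⟨x, hx, y, hy, rfl⟩ := Finset.mem_add.1 (Finset.mem_coe.1 (hV hv))
    have hxy := hammingNorm_add_le_add x y
    simp only [Finset.mem_filter, Finset.mem_univ, true_and] at hx hy
    have hcodim : Module.finrank (ZMod 2) V + s ≤ n := by omega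
    have : (Module.finrank (ZMod 2) V : ℝ) + s ≤ n := by exact_mod_cast hcodim
    linarith
end

section
/- There are absolute constants c > 0 and C ≥ 0 such that the following holds: if A ⊆ G := 𝔽₂ⁿ has density α > 0, then A + A contains a subspace of dimension at least c·α·n − C. -/
open Pointwise

section SignCharacters

/-- The nontrivial real character of `ZMod 2`. -/
def zmodTwoSign (z : ZMod 2) : ℝ := if z = 0 then 1 else -1

lemma zmodTwoSign_zero : zmodTwoSign 0 = 1 := if_pos rfl

lemma zmodTwoSign_one : zmodTwoSign 1 = -1 := if_neg one_ne_zero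

lemma zmodTwoSign_add (x y : ZMod 2) : zmodTwoSign (x + y) = zmodTwoSign x * zmodTwoSign y := by
  have h (z : ZMod 2) : z = 0 ∨ z = 1 := by revert z; decide
  rcases h x with rfl | rfl <;> rcases h y with rfl | rfl <;>
    simp [zmodTwoSign_zero, zmodTwoSign_one, CharTwo.add_self_eq_zero]

variable {V : Type*} [AddCommGroup V] [Module (ZMod 2) V]

lemma add_self_eq_zero_of_module_zmod_two (x : V) : x + x = 0 := by
  rw [← two_smul (ZMod 2) x, show (2 : ZMod 2) = 0 from rfl, zero_smul]

lemma two_mul_card_filter_ker (B : Finset V) (f : Module.Dual (ZMod 2) V) :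
    (2 : ℝ) * (B.filter fun b => f b = 0).card = B.card + ∑ b ∈ B, zmodTwoSign (f b) := by
  rw [Finset.card_filter, Finset.card_eq_sum_ones]
  push_cast
  rw [Finset.mul_sum, ← Finset.sum_add_distrib]
  refine Finset.sum_congr rfl fun b _ => ?_
  unfold zmodTwoSign
  split_ifs <;> norm_num

variable [Fintype V] [Fintype (Module.Dual (ZMod 2) V)]

lemma card_dual_zmod_two : Fintype.card (Module.Dual (ZMod 2) V) = Fintype.card V := by
  rw [Module.card_eq_pow_finrank (K := ZMod 2) (V := V),
    Module.card_eq_pow_finrank (K := ZMod 2) (V := Module.Dual (ZMod 2) V),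
    Subspace.dual_finrank_eq]

lemma sum_zmodTwoSign_dual_of_ne_zero {x : V} (hx : x ≠ 0) :
    ∑ f : Module.Dual (ZMod 2) V, zmodTwoSign (f x) = 0 := by
  obtain ⟨g, hg⟩ : ∃ g : Module.Dual (ZMod 2) V, g x ≠ 0 := by
    by_contra! h
    exact hx ((Module.forall_dual_apply_eq_zero_iff (ZMod 2) x).1 h)
  have hg1 : g x = 1 := Fin.eq_one_of_ne_zero _ hg
  have h : ∑ f : Module.Dual (ZMod 2) V, zmodTwoSign ((f + g) x) =
      ∑ f : Module.Dual (ZMod 2) V, zmodTwoSign (f x) :=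
    Equiv.sum_comp (Equiv.addRight g) fun f : Module.Dual (ZMod 2) V => zmodTwoSign (f x)
  simp only [LinearMap.add_apply, zmodTwoSign_add, hg1, zmodTwoSign_one, mul_neg, mul_one,
    Finset.sum_neg_distrib] at h
  linarith

lemma sum_zmodTwoSign_dual [DecidableEq V] (x : V) :
    ∑ f : Module.Dual (ZMod 2) V, zmodTwoSign (f x) = if x = 0 then (Fintype.card V : ℝ) else 0 := by
  split_ifs with hx
  · simp [hx, zmodTwoSign_zero, card_dual_zmod_two]
  · exact sum_zmodTwoSign_dual_of_ne_zero hx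

/-- Parseval's identity for the indicator of `A`. -/
lemma sum_sq_sum_zmodTwoSign (A : Finset V) :
    ∑ f : Module.Dual (ZMod 2) V, (∑ a ∈ A, zmodTwoSign (f a)) ^ 2 =
      Fintype.card V * A.card := by
  classical
  have h (f : Module.Dual (ZMod 2) V) : (∑ a ∈ A, zmodTwoSign (f a)) ^ 2 =
      ∑ a ∈ A, ∑ b ∈ A, zmodTwoSign (f (a - b)) := by
    rw [sq, Finset.sum_mul_sum]
    refine Finset.sum_congr rfl fun a _ => Finset.sum_congr rfl fun b _ => ?_
    rw [← zmodTwoSign_add, map_sub, CharTwo.sub_eq_add]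
  simp only [h]
  rw [Finset.sum_comm]
  simp_rw [Finset.sum_comm (s := Finset.univ), sum_zmodTwoSign_dual, sub_eq_zero]
  simp [mul_comm]

/-- The Fourier expression for the number of solutions to `a + a' = b` vanishes when `B` avoids
`A + A`. -/
lemma sum_sq_mul_sum_zmodTwoSign_eq_zero {A B : Finset V}
    (hAB : ∀ a ∈ A, ∀ a' ∈ A, a + a' ∉ B) :
    ∑ f : Module.Dual (ZMod 2) V,
      (∑ a ∈ A, zmodTwoSign (f a)) ^ 2 * ∑ b ∈ B, zmodTwoSign (f b) = 0 := by
  have h (f : Module.Dual (ZMod 2) V) :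
      (∑ a ∈ A, zmodTwoSign (f a)) ^ 2 * ∑ b ∈ B, zmodTwoSign (f b) =
      ∑ a ∈ A, ∑ a' ∈ A, ∑ b ∈ B, zmodTwoSign (f (a + a' - b)) := by
    rw [sq, Finset.sum_mul_sum, Finset.sum_mul]
    refine Finset.sum_congr rfl fun a _ => ?_
    rw [Finset.sum_mul]
    refine Finset.sum_congr rfl fun a' _ => ?_
    rw [Finset.mul_sum]
    refine Finset.sum_congr rfl fun b _ => ?_
    rw [← zmodTwoSign_add, ← zmodTwoSign_add, map_sub, CharTwo.sub_eq_add, map_add]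
  simp only [h]
  rw [Finset.sum_comm]
  refine Finset.sum_eq_zero fun a ha => ?_
  rw [Finset.sum_comm]
  refine Finset.sum_eq_zero fun a' ha' => ?_
  rw [Finset.sum_comm]
  refine Finset.sum_eq_zero fun b hb => sum_zmodTwoSign_dual_of_ne_zero fun h0 => ?_
  exact hAB a ha a' ha' (sub_eq_zero.1 h0 ▸ hb)

end SignCharacters

section Hyperplanes

variable {V : Type*} [AddCommGroup V] [Module (ZMod 2) V] [Fintype V]

/-- If `B` avoids `A + A`, then the indicator of `B` has a large negative nontrivial Fourier
coefficient. -/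
lemma exists_dual_sum_zmodTwoSign_le [Nontrivial V] {A B : Finset V} (hA : A.Nonempty)
    (hAB : ∀ a ∈ A, ∀ a' ∈ A, a + a' ∉ B) {α : ℝ} (hpos : 0 < α)
    (hα : α * Fintype.card V ≤ A.card) :
    ∃ f : Module.Dual (ZMod 2) V, f ≠ 0 ∧ ∑ b ∈ B, zmodTwoSign (f b) ≤ -(α * B.card) := by
  classical
  have : Fintype (Module.Dual (ZMod 2) V) := @Fintype.ofFinite _ (DFunLike.finite _)
  rcases B.eq_empty_or_nonempty with rfl | hB
  · obtain ⟨f, hf⟩ := exists_ne (0 : Module.Dual (ZMod 2) V)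
    exact ⟨f, hf, by simp⟩
  by_contra! hcon
  have hparseval := sum_sq_sum_zmodTwoSign A
  have hzero := sum_sq_mul_sum_zmodTwoSign_eq_zero hAB
  rw [← Finset.add_sum_erase _ _ (Finset.mem_univ (0 : Module.Dual (ZMod 2) V))]
    at hparseval hzero
  simp only [LinearMap.zero_apply, zmodTwoSign_zero, Finset.sum_const, nsmul_eq_mul, mul_one]
    at hparseval hzero
  have hle : ∑ f ∈ Finset.univ.erase (0 : Module.Dual (ZMod 2) V),
        (∑ a ∈ A, zmodTwoSign (f a)) ^ 2 * -(α * B.card) ≤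
      ∑ f ∈ Finset.univ.erase (0 : Module.Dual (ZMod 2) V),
        (∑ a ∈ A, zmodTwoSign (f a)) ^ 2 * ∑ b ∈ B, zmodTwoSign (f b) :=
    Finset.sum_le_sum fun f hf =>
      mul_le_mul_of_nonneg_left (hcon f (Finset.ne_of_mem_erase hf)).le (sq_nonneg _)
  rw [← Finset.sum_mul] at hle
  have ha : (0 : ℝ) < A.card := by exact_mod_cast hA.card_pos
  have hb : (0 : ℝ) < B.card := by exact_mod_cast hB.card_pos
  rw [← eq_sub_iff_add_eq'] at hparseval
  rw [hparseval] at hle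
  have h1 := mul_nonneg (mul_pos ha hb).le (sub_nonneg.2 hα)
  have h2 := mul_pos (mul_pos (mul_pos ha ha) hpos) hb
  nlinarith

/-- Some translate of a subspace contains at least the expected proportion of `A`. -/
lemma exists_card_translate_ge [DecidableEq V] (H : Submodule (ZMod 2) V) [Fintype H]
    {A : Finset V} {α : ℝ} (hα : α * Fintype.card V ≤ A.card) :
    ∃ t : V, α * Fintype.card H ≤ (Finset.univ.filter fun h : H => t + h ∈ A).card := by
  have hsum : ∑ t : V, ((Finset.univ.filter fun h : H => t + h ∈ A).card : ℝ) =
      Fintype.card H * A.card := by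
    simp_rw [Finset.card_filter]
    push_cast
    rw [Finset.sum_comm]
    have h (x : H) : ∑ t : V, (if t + (x : V) ∈ A then (1 : ℝ) else 0) = A.card := by
      refine (Equiv.sum_comp (Equiv.addRight (x : V)) fun t => if t ∈ A then (1 : ℝ) else 0).trans ?_
      simp
    simp [h]
  obtain ⟨t, -, ht⟩ := Finset.exists_le_of_sum_le (s := (Finset.univ : Finset V))
    (f := fun _ => α * Fintype.card H)
    (g := fun t => ((Finset.univ.filter fun h : H => t + h ∈ A).card : ℝ))
    Finset.univ_nonempty (by
      rw [hsum, Finset.sum_const, nsmul_eq_mul, Finset.card_univ]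
      nlinarith [(Nat.cast_nonneg (Fintype.card H) : (0 : ℝ) ≤ _)])
  exact ⟨t, ht⟩

end Hyperplanes

universe u

/-- A set avoiding `A + A` becomes exponentially sparse on a subspace of codimension `k`. -/
lemma exists_submodule_card_filter_le {α : ℝ} (hα : 0 < α) (k : ℕ) :
    ∀ (V : Type u) [AddCommGroup V] [Module (ZMod 2) V] [Fintype V] (A B : Finset V),
      (∀ a ∈ A, ∀ a' ∈ A, a + a' ∉ B) → α * Fintype.card V ≤ A.card →
      k ≤ Module.finrank (ZMod 2) V →
      ∃ W : Submodule (ZMod 2) V, Module.finrank (ZMod 2) W + k = Module.finrank (ZMod 2) V ∧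
        ∃ S : Finset V, (∀ x, x ∈ S ↔ x ∈ B ∧ x ∈ W) ∧
          (2 : ℝ) ^ k * S.card ≤ (1 - α) ^ k * B.card := by
  induction k with
  | zero =>
    intro V _ _ _ A B _ _ _
    exact ⟨⊤, by simp, B, by simp, by simp⟩
  | succ k ih =>
    intro V _ _ _ A B hAB hA hk
    classical
    have : Nontrivial V := Module.nontrivial_of_finrank_pos (R := ZMod 2) (by omega)
    have hv : (0 : ℝ) < Fintype.card V := by exact_mod_cast Fintype.card_pos
    have hAne : A.Nonempty := by
      rw [← Finset.card_pos]
      exact_mod_cast (mul_pos hα hv).trans_le hA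
    have hα1 : α ≤ 1 := by
      have : (A.card : ℝ) ≤ Fintype.card V := by exact_mod_cast A.card_le_univ
      nlinarith
    obtain ⟨f, hf, hfB⟩ := exists_dual_sum_zmodTwoSign_le hAne hAB hα hA
    have hker := Module.Dual.finrank_ker_add_one_of_ne_zero hf
    obtain ⟨t, ht⟩ := exists_card_translate_ge (LinearMap.ker f) hA
    obtain ⟨W, hW, S, hS, hcard⟩ := ih (LinearMap.ker f)
      (Finset.univ.filter fun h : LinearMap.ker f => t + h ∈ A)
      (Finset.univ.filter fun h : LinearMap.ker f => (h : V) ∈ B) (by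
        simp only [Finset.mem_filter_univ]
        intro a ha a' ha' h
        refine hAB _ ha _ ha' ?_
        rwa [add_add_add_comm, add_self_eq_zero_of_module_zmod_two, zero_add])
      ht (by omega)
    refine ⟨W.map (LinearMap.ker f).subtype, ?_, S.map (Function.Embedding.subtype _), ?_, ?_⟩
    · have := (Submodule.equivSubtypeMap (LinearMap.ker f) W).finrank_eq
      omega
    · intro x
      simp only [Finset.mem_map, Submodule.mem_map, hS, Finset.mem_filter_univ]
      constructor
      · rintro ⟨y, ⟨hyB, hyW⟩, rfl⟩
        exact ⟨hyB, y, hyW, rfl⟩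
      · rintro ⟨hxB, y, hyW, rfl⟩
        exact ⟨y, ⟨hxB, hyW⟩, rfl⟩
    · have hB : (Finset.univ.filter fun h : LinearMap.ker f => (h : V) ∈ B).card =
          (B.filter fun b => f b = 0).card := by
        rw [← Finset.card_map (Function.Embedding.subtype _)]
        congr 1
        ext x
        simp [and_comm]
      have h2 := two_mul_card_filter_ker B f
      rw [hB] at hcard
      rw [Finset.card_map, pow_succ, pow_succ]
      have h3 : (2 : ℝ) * (B.filter fun b => f b = 0).card ≤ (1 - α) * B.card := by linarith
      calc (2 : ℝ) ^ k * 2 * S.card = 2 * (2 ^ k * S.card) := by ring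
        _ ≤ 2 * ((1 - α) ^ k * (B.filter fun b => f b = 0).card) := by gcongr
        _ = (1 - α) ^ k * (2 * (B.filter fun b => f b = 0).card) := by ring
        _ ≤ (1 - α) ^ k * ((1 - α) * B.card) :=
            mul_le_mul_of_nonneg_left h3 (pow_nonneg (by linarith) k)
        _ = (1 - α) ^ k * (1 - α) * B.card := by ring

lemma one_sub_le_two_rpow_neg {α : ℝ} (hα : 0 ≤ α) : 1 - α ≤ (2 : ℝ) ^ (-α) := by
  rw [Real.rpow_def_of_pos two_pos]
  have h1 := Real.add_one_le_exp (Real.log 2 * -α)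
  have h2 : Real.log 2 ≤ 1 := by linarith [Real.log_two_lt_d9]
  nlinarith

lemma one_sub_pow_mul_two_pow_lt {α : ℝ} (hα : 0 ≤ α) (hα1 : α ≤ 1) {n k : ℕ}
    (hk : (n : ℝ) < (1 + α) * k) : (1 - α) ^ k * 2 ^ n < (2 : ℝ) ^ k := by
  calc (1 - α) ^ k * 2 ^ n ≤ ((2 : ℝ) ^ (-α)) ^ k * 2 ^ n := by
        gcongr
        exact one_sub_le_two_rpow_neg hα
    _ = (2 : ℝ) ^ (-α * k + n) := by
        rw [Real.rpow_add two_pos, Real.rpow_mul two_pos.le, Real.rpow_natCast, Real.rpow_natCast]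
    _ < (2 : ℝ) ^ (k : ℝ) := Real.rpow_lt_rpow_of_exponent_lt one_lt_two (by linarith)
    _ = 2 ^ k := Real.rpow_natCast 2 k

/-- There are `c > 0` and `C ≥ 0` such that if `A ⊆ 𝔽₂ⁿ` has density `α > 0`,
then `A + A` contains a subspace of dimension at least `c α n - C`. -/
theorem sumset_contains_subspace_dim_ge :
    ∃ c C : ℝ, 0 < c ∧ 0 ≤ C ∧ ∀ (n : ℕ) (A : Finset (Fin n → ZMod 2)) (α : ℝ),
      α = (A.card : ℝ) / 2 ^ n → 0 < α →
      ∃ V : Submodule (ZMod 2) (Fin n → ZMod 2),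
        (V : Set (Fin n → ZMod 2)) ⊆ ((A + A : Finset (Fin n → ZMod 2)) : Set (Fin n → ZMod 2)) ∧
        c * α * n - C ≤ (Module.finrank (ZMod 2) V : ℝ) := by
  refine ⟨1 / 2, 1, by norm_num, zero_le_one, fun n A α hα hpos => ?_⟩
  have hcardV : Fintype.card (Fin n → ZMod 2) = 2 ^ n := by simp [ZMod.card]
  have hAα : (A.card : ℝ) = α * 2 ^ n := by rw [hα]; field_simp
  have hα1 : α ≤ 1 := by
    rw [hα, div_le_one (by positivity)]
    exact_mod_cast hcardV ▸ A.card_le_univ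
  have hn : (0 : ℝ) ≤ n := n.cast_nonneg
  have hfloor := Nat.floor_le (show 0 ≤ (n : ℝ) / (1 + α) by positivity)
  have hlt := Nat.lt_floor_add_one ((n : ℝ) / (1 + α))
  set k := ⌊(n : ℝ) / (1 + α)⌋₊ + 1 with hk
  have hkup : (k : ℝ) ≤ n - 1 / 2 * α * n + 1 := by
    have : (n : ℝ) / (1 + α) ≤ n - 1 / 2 * α * n := by
      rw [div_le_iff₀ (by linarith)]
      nlinarith [mul_nonneg hn (mul_nonneg hpos.le (sub_nonneg.2 hα1))]
    push_cast [hk]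
    linarith
  by_cases hkn : k ≤ n
  · obtain ⟨W, hW, S, hS, hcard⟩ := exists_submodule_card_filter_le hpos k
      (Fin n → ZMod 2) A (A + A)ᶜ
      (fun a ha a' ha' => by simpa using Finset.add_mem_add ha ha')
      (by rw [hcardV, hAα]; push_cast; rfl) (by simpa using hkn)
    have hSempty : S = ∅ := by
      by_contra hne
      have h1 : (1 : ℝ) ≤ S.card := by
        exact_mod_cast (Finset.nonempty_iff_ne_empty.2 hne).card_pos
      have h2 : (((A + A)ᶜ : Finset (Fin n → ZMod 2)).card : ℝ) ≤ 2 ^ n := by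
        exact_mod_cast hcardV ▸ Finset.card_le_univ _
      have h3 : (n : ℝ) < (1 + α) * k := by
        rw [div_lt_iff₀ (by linarith)] at hlt
        push_cast [hk]
        linarith
      have h4 := one_sub_pow_mul_two_pow_lt hpos.le hα1 h3
      have h5 := mul_le_mul_of_nonneg_left h2 (pow_nonneg (sub_nonneg.2 hα1) k)
      have h6 := mul_le_mul_of_nonneg_left h1 (pow_nonneg (zero_le_two (α := ℝ)) k)
      linarith
    refine ⟨W, fun x hx => ?_, ?_⟩
    · by_contra hxA
      have : x ∈ S := (hS x).2 ⟨Finset.mem_compl.2 hxA, hx⟩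
      simp [hSempty] at this
    · rw [Module.finrank_fin_fun] at hW
      have : (Module.finrank (ZMod 2) W : ℝ) + k = n := by exact_mod_cast hW
      linarith
  · have hA : A.Nonempty := by
      rw [← Finset.card_pos]
      have : (0 : ℝ) < A.card := by rw [hAα]; positivity
      exact_mod_cast this
    obtain ⟨a, ha⟩ := hA
    refine ⟨⊥, ?_, ?_⟩
    · rintro x rfl
      rw [← add_self_eq_zero_of_module_zmod_two a]
      exact Finset.add_mem_add ha ha
    · have : (n : ℝ) + 1 ≤ k := by exact_mod_cast not_le.1 hkn
      simp only [finrank_bot, Nat.cast_zero]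
      linarith
end

section
/- Suppose that A ⊆ G := 𝔽₂ⁿ has density α with 0 < α < 1/2. Then A + A contains a subspace of co-dimension ⌈n / log₂((2 − 2α)/(1 − 2α))⌉. -/
open Pointwise

/-- The nontrivial real character of `ZMod 2`. -/
def signChar (c : ZMod 2) : ℝ := if c = 0 then 1 else -1

lemma signChar_add (a b : ZMod 2) : signChar (a + b) = signChar a * signChar b := by
  have h : (1 : ZMod 2) + 1 = 0 := rfl
  have hcases : ∀ c : ZMod 2, c = 0 ∨ c = 1 := by decide
  obtain rfl | rfl := hcases a <;> obtain rfl | rfl := hcases b <;> simp [signChar, h]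

lemma add_eq_zero_iff_eq_of_zmod_two {ι : Type*} (u v : ι → ZMod 2) : u + v = 0 ↔ u = v := by
  simp only [funext_iff, Pi.add_apply, Pi.zero_apply, CharTwo.add_eq_zero]

/-- Orthogonality of the characters of `𝔽₂ⁿ`. -/
lemma sum_signChar_dotProduct {n : ℕ} (v : Fin n → ZMod 2) :
    ∑ γ : Fin n → ZMod 2, signChar (γ ⬝ᵥ v) = if v = 0 then 2 ^ n else 0 := by
  split_ifs with hv
  · simp [hv, signChar, ZMod.card]
  · obtain ⟨i, hi⟩ := Function.ne_iff.mp hv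
    have hflip : ∑ γ : Fin n → ZMod 2, signChar (γ ⬝ᵥ v) =
        ∑ γ : Fin n → ZMod 2, -signChar (γ ⬝ᵥ v) := by
      rw [← Equiv.sum_comp (Equiv.addRight (Pi.single i (1 : ZMod 2)))]
      refine Finset.sum_congr rfl fun γ _ => ?_
      simp only [Equiv.coe_addRight, add_dotProduct, signChar_add, single_dotProduct, one_mul]
      simp [signChar, show v i ≠ 0 from hi]
    rw [Finset.sum_neg_distrib] at hflip
    linarith

/-- The squared (unnormalised) Fourier coefficient of the indicator of `A` at `γ`. -/
noncomputable def fourierWeight {n : ℕ} (A : Finset (Fin n → ZMod 2)) (γ : Fin n → ZMod 2) : ℝ :=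
  (∑ a ∈ A, signChar (γ ⬝ᵥ a)) ^ 2

lemma fourierWeight_nonneg {n : ℕ} (A : Finset (Fin n → ZMod 2)) (γ : Fin n → ZMod 2) :
    0 ≤ fourierWeight A γ := sq_nonneg _

lemma fourierWeight_zero {n : ℕ} (A : Finset (Fin n → ZMod 2)) :
    fourierWeight A 0 = (A.card : ℝ) ^ 2 := by
  simp [fourierWeight, signChar]

/-- Fourier inversion for the autocorrelation of `A`. -/
lemma sum_fourierWeight_mul_signChar {n : ℕ} (A : Finset (Fin n → ZMod 2)) (x : Fin n → ZMod 2) :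
    ∑ γ, fourierWeight A γ * signChar (γ ⬝ᵥ x) =
      ∑ a ∈ A, ∑ b ∈ A, if a + b = x then (2 : ℝ) ^ n else 0 := by
  have hexpand (γ : Fin n → ZMod 2) : fourierWeight A γ * signChar (γ ⬝ᵥ x) =
      ∑ a ∈ A, ∑ b ∈ A, signChar (γ ⬝ᵥ (a + b + x)) := by
    rw [fourierWeight, sq, Finset.sum_mul_sum]
    simp only [Finset.sum_mul, dotProduct_add, signChar_add]
  simp only [hexpand]
  rw [Finset.sum_comm]
  refine Finset.sum_congr rfl fun a _ => ?_
  rw [Finset.sum_comm]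
  refine Finset.sum_congr rfl fun b _ => ?_
  simp only [sum_signChar_dotProduct, add_eq_zero_iff_eq_of_zmod_two]

lemma sum_fourierWeight {n : ℕ} (A : Finset (Fin n → ZMod 2)) :
    ∑ γ, fourierWeight A γ = 2 ^ n * A.card := by
  have h := sum_fourierWeight_mul_signChar A 0
  simp only [dotProduct_zero, add_eq_zero_iff_eq_of_zmod_two, Finset.sum_ite_eq] at h
  simpa [signChar, mul_comm] using h

lemma two_mul_sum_fourierWeight_orthogonal {n : ℕ} (A : Finset (Fin n → ZMod 2))
    {x : Fin n → ZMod 2} (hx : x ∉ A + A) :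
    2 * ∑ γ with γ ⬝ᵥ x = 0, fourierWeight A γ = 2 ^ n * A.card := by
  have h : ∑ γ, fourierWeight A γ * signChar (γ ⬝ᵥ x) = 0 := by
    rw [sum_fourierWeight_mul_signChar]
    refine Finset.sum_eq_zero fun a ha => Finset.sum_eq_zero fun b hb => if_neg ?_
    rintro rfl
    exact hx (Finset.add_mem_add ha hb)
  rw [← sum_fourierWeight, ← add_zero (∑ γ, _), ← h, ← Finset.sum_add_distrib, Finset.sum_filter,
    Finset.mul_sum]
  refine Finset.sum_congr rfl fun γ _ => ?_
  unfold signChar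
  split_ifs <;> ring

/-- Some hyperplane contains only a small proportion of any set disjoint from `A + A`. -/
lemma exists_hyperplane_card_le {n : ℕ} (A T : Finset (Fin n → ZMod 2)) {α : ℝ}
    (hα : α = (A.card : ℝ) / 2 ^ n) (hα₀ : 0 < α) (hα₁ : α < 1 / 2) (hT : Disjoint T (A + A)) :
    ∃ γ : Fin n → ZMod 2, ((T.filter fun x => γ ⬝ᵥ x = 0).card : ℝ) ≤
      (1 - 2 * α) / (2 - 2 * α) * T.card := by
  have hcard : (A.card : ℝ) = α * 2 ^ n := by rw [hα]; field_simp
  set N : ℝ := 2 ^ n with hN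
  have hNpos : 0 < N := by positivity
  by_contra! hlarge
  set r : ℝ := (1 - 2 * α) / (2 - 2 * α) with hr
  have hW : ∑ γ ∈ Finset.univ.erase 0, fourierWeight A γ = N ^ 2 * (α - α ^ 2) := by
    rw [Finset.sum_erase_eq_sub (Finset.mem_univ _), sum_fourierWeight, fourierWeight_zero, hcard]
    ring
  have hcount : ∑ γ ∈ Finset.univ.erase 0,
      fourierWeight A γ * ((T.filter fun x => γ ⬝ᵥ x = 0).card : ℝ) =
        T.card * (N ^ 2 * (α / 2 - α ^ 2)) := by
    have hx (x) (hx : x ∈ T) : ∑ γ ∈ Finset.univ.erase 0,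
        (if γ ⬝ᵥ x = 0 then fourierWeight A γ else 0) = N ^ 2 * (α / 2 - α ^ 2) := by
      have h := two_mul_sum_fourierWeight_orthogonal A (Finset.disjoint_left.mp hT hx)
      rw [Finset.sum_filter, hcard] at h
      rw [Finset.sum_erase_eq_sub (Finset.mem_univ _), zero_dotProduct, if_pos rfl,
        fourierWeight_zero, hcard]
      linarith
    rw [← nsmul_eq_mul, ← Finset.sum_const, ← Finset.sum_congr rfl hx, Finset.sum_comm]
    refine Finset.sum_congr rfl fun γ _ => ?_
    rw [← Finset.sum_filter, Finset.sum_const, nsmul_eq_mul, mul_comm]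
  have hWpos : 0 < ∑ γ ∈ Finset.univ.erase 0, fourierWeight A γ := by
    rw [hW]
    have : 0 < α - α ^ 2 := by nlinarith
    positivity
  obtain ⟨γ₀, hγ₀, hγ₀pos⟩ := Finset.exists_lt_of_sum_lt (Finset.sum_const_zero.trans_lt hWpos)
  have hlt : ∑ γ ∈ Finset.univ.erase 0, fourierWeight A γ * (r * T.card) <
      ∑ γ ∈ Finset.univ.erase 0,
        fourierWeight A γ * ((T.filter fun x => γ ⬝ᵥ x = 0).card : ℝ) :=
    Finset.sum_lt_sum
      (fun γ _ => mul_le_mul_of_nonneg_left (hlarge γ).le (fourierWeight_nonneg A γ))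
      ⟨γ₀, hγ₀, mul_lt_mul_of_pos_left (hlarge γ₀) hγ₀pos⟩
  rw [← Finset.sum_mul, hW, hcount] at hlt
  have hrα : (α - α ^ 2) * r = α / 2 - α ^ 2 := by
    have : 2 - 2 * α ≠ 0 := by linarith
    rw [hr, mul_div_assoc', div_eq_iff this]
    ring
  rw [← hrα] at hlt
  exact hlt.ne (by ring)

lemma finrank_le_finrank_inf_ker_add_one {K E : Type*} [Field K] [AddCommGroup E] [Module K E]
    [FiniteDimensional K E] (V : Submodule K E) (φ : E →ₗ[K] K) :
    Module.finrank K V ≤ Module.finrank K (V ⊓ LinearMap.ker φ : Submodule K E) + 1 := by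
  have h₁ := Submodule.finrank_sup_add_finrank_inf_eq V (LinearMap.ker φ)
  have h₂ := LinearMap.finrank_range_add_finrank_ker φ
  have h₃ := Submodule.finrank_le (V ⊔ LinearMap.ker φ)
  have h₄ := Submodule.finrank_le (LinearMap.range φ)
  rw [Module.finrank_self] at h₄
  omega

open Classical in
/-- Iterating `exists_hyperplane_card_le`. -/
lemma exists_subspace_card_le {n : ℕ} (A T : Finset (Fin n → ZMod 2)) {α : ℝ}
    (hα : α = (A.card : ℝ) / 2 ^ n) (hα₀ : 0 < α) (hα₁ : α < 1 / 2) (hT : Disjoint T (A + A))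
    (d : ℕ) : ∃ V : Submodule (ZMod 2) (Fin n → ZMod 2),
      n ≤ Module.finrank (ZMod 2) V + d ∧
      ((T.filter (· ∈ V)).card : ℝ) ≤ ((1 - 2 * α) / (2 - 2 * α)) ^ d * T.card := by
  induction d with
  | zero => exact ⟨⊤, by simp, by simp⟩
  | succ d ih =>
    obtain ⟨V, hV, hcard⟩ := ih
    obtain ⟨γ, hγ⟩ := exists_hyperplane_card_le A (T.filter (· ∈ V)) hα hα₀ hα₁
      (Finset.disjoint_of_subset_left (Finset.filter_subset _ _) hT)
    refine ⟨V ⊓ LinearMap.ker (dotProductBilin (ZMod 2) (ZMod 2) γ), ?_, ?_⟩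
    · have := finrank_le_finrank_inf_ker_add_one V (dotProductBilin (ZMod 2) (ZMod 2) γ)
      omega
    · have hr : 0 ≤ (1 - 2 * α) / (2 - 2 * α) := div_nonneg (by linarith) (by linarith)
      rw [Finset.filter_filter] at hγ
      simp only [Submodule.mem_inf, LinearMap.mem_ker, dotProductBilin_apply_apply]
      rw [pow_succ', mul_assoc]
      exact hγ.trans (mul_le_mul_of_nonneg_left hcard hr)

lemma exists_submodule_le_finrank_eq {K E : Type*} [Field K] [AddCommGroup E] [Module K E]
    [FiniteDimensional K E] (V : Submodule K E) {k : ℕ} (hk : k ≤ Module.finrank K V) :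
    ∃ W ≤ V, Module.finrank K W = k := by
  let b := Module.finBasis K V
  have hb : LinearIndependent K fun i : Fin k => (b (Fin.castLE hk i) : E) :=
    (b.linearIndependent.map' V.subtype V.ker_subtype).comp _ (Fin.castLE_injective hk)
  refine ⟨Submodule.span K (Set.range fun i : Fin k => (b (Fin.castLE hk i) : E)), ?_, ?_⟩
  · rw [Submodule.span_le]
    rintro _ ⟨i, rfl⟩
    exact (b _).2
  · rw [finrank_span_eq_card hb, Fintype.card_fin]

/-- If `A ⊆ 𝔽₂ⁿ` has density `α` with `0 < α < 1/2`, then `A + A` contains a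
subspace of co-dimension `⌈n / log₂((2 - 2α)/(1 - 2α))⌉`. -/
theorem sumset_contains_subspace_codim_ceil {n : ℕ} (A : Finset (Fin n → ZMod 2)) (α : ℝ)
    (hα : α = (A.card : ℝ) / 2 ^ n) (hα₀ : 0 < α) (hα₁ : α < 1 / 2) :
    ∃ V : Submodule (ZMod 2) (Fin n → ZMod 2),
      Module.finrank (ZMod 2) V = n - ⌈(n : ℝ) / Real.logb 2 ((2 - 2 * α) / (1 - 2 * α))⌉₊ ∧
      (V : Set (Fin n → ZMod 2)) ⊆ ((A + A : Finset (Fin n → ZMod 2)) : Set (Fin n → ZMod 2)) := by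
  classical
  set ρ : ℝ := (2 - 2 * α) / (1 - 2 * α) with hρ
  set d : ℕ := ⌈(n : ℝ) / Real.logb 2 ρ⌉₊ with hd
  have hρ₁ : 1 < ρ := by
    rw [hρ, one_lt_div (by linarith)]
    linarith
  have hpow : (2 : ℝ) ^ n ≤ ρ ^ d := by
    have hlog : (n : ℝ) ≤ d * Real.logb 2 ρ :=
      (div_le_iff₀ (Real.logb_pos one_lt_two hρ₁)).mp (Nat.le_ceil _)
    rwa [← Real.logb_pow, Real.le_logb_iff_rpow_le one_lt_two (by positivity),
      Real.rpow_natCast] at hlog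
  obtain ⟨V, hV, hcard⟩ := exists_subspace_card_le A (Finset.univ \ (A + A)) hα hα₀ hα₁
    Finset.sdiff_disjoint d
  obtain ⟨W, hWV, hW⟩ := exists_submodule_le_finrank_eq V (Nat.sub_le_of_le_add hV)
  refine ⟨W, hW, fun x hx => ?_⟩
  have hA : A.Nonempty := by
    rw [Finset.nonempty_iff_ne_empty]
    rintro rfl
    simp [hα] at hα₀
  have hS : ((Finset.univ \ (A + A)).card : ℝ) < 2 ^ n := by
    have h : (Finset.univ \ (A + A)).card < (Finset.univ : Finset (Fin n → ZMod 2)).card :=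
      Finset.card_lt_card (Finset.sdiff_ssubset (Finset.subset_univ _) (hA.add hA))
    rw [Finset.card_univ, Fintype.card_fun, ZMod.card, Fintype.card_fin] at h
    exact_mod_cast h
  have hlt : (((Finset.univ \ (A + A)).filter (· ∈ V)).card : ℝ) < 1 := by
    refine hcard.trans_lt ?_
    rw [← inv_div, ← hρ, inv_pow, inv_mul_lt_one₀ (by positivity)]
    exact hS.trans_le hpow
  have hempty : (Finset.univ \ (A + A)).filter (· ∈ V) = ∅ := by
    rw [← Finset.card_eq_zero]
    exact Nat.lt_one_iff.mp (by exact_mod_cast hlt)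
  by_contra hxA
  have hmem : x ∈ (Finset.univ \ (A + A)).filter (· ∈ V) := by
    simp only [Finset.mem_filter, Finset.mem_sdiff, Finset.mem_univ, true_and]
    exact ⟨fun h => hxA (Finset.mem_coe.mpr h), hWV hx⟩
  simp [hempty] at hmem
end

section
/- Let G = 𝔽₂ⁿ and let η ≥ 0. Define A := {x ∈ 𝔽₂ⁿ : x has at most n/2 − η√(2πn)/2 coordinates equal to 1 (in the standard basis)}. Then ℙ_G(A) ≥ 1/2 − η − 3.2/√n. -/
/-- The Wallis bound on central binomial coefficients: `C(2m, m) ≤ 4 ^ m / √(π m)`, squared. -/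
lemma Nat.centralBinom_sq_mul_pi_le (m : ℕ) :
    (m.centralBinom : ℝ) ^ 2 * (Real.pi * m) ≤ 16 ^ m := by
  have hW : (m.centralBinom : ℝ) ^ 2 * (2 * m + 1) * Real.Wallis.W m = 16 ^ m := by
    induction m with
    | zero => simp [Real.Wallis.W]
    | succ k ih =>
      have h : ((k : ℝ) + 1) * (k + 1).centralBinom = 2 * (2 * k + 1) * k.centralBinom := by
        exact_mod_cast k.succ_mul_centralBinom_succ
      have h' : ((k + 1).centralBinom : ℝ) = 2 * (2 * k + 1) * k.centralBinom / (k + 1) := by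
        field_simp
        linarith
      rw [Real.Wallis.W_succ, h', pow_succ (16 : ℝ), ← ih]
      push_cast
      field_simp
      ring
  have hle := Real.Wallis.le_W m
  have hmono : Real.pi * m ≤ (2 * m + 1) * Real.Wallis.W m := by
    refine le_trans ?_ (mul_le_mul_of_nonneg_left hle (by positivity))
    rw [show (2 * (m : ℝ) + 1) * ((2 * m + 1) / (2 * m + 2) * (Real.pi / 2)) =
      Real.pi * ((2 * m + 1) ^ 2 / (2 * (2 * m + 2))) by field_simp]
    refine mul_le_mul_of_nonneg_left ?_ Real.pi_pos.le
    rw [le_div_iff₀ (by positivity)]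
    nlinarith
  rw [← hW, mul_assoc]
  gcongr

/-- The largest binomial coefficient satisfies `C(n, n / 2) ≤ 2 ^ n √(2 / (π n))`. -/
lemma Nat.choose_half_mul_sqrt_le (n : ℕ) :
    (n.choose (n / 2) : ℝ) * (Real.sqrt (2 * Real.pi * n) / 2) ≤ 2 ^ n := by
  refine le_of_sq_le_sq ?_ (by positivity)
  rw [mul_pow, div_pow, Real.sq_sqrt (by positivity)]
  obtain ⟨m, rfl | rfl⟩ := n.even_or_odd'
  · have h := m.centralBinom_sq_mul_pi_le
    rw [Nat.centralBinom] at h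
    rw [Nat.mul_div_cancel_left m two_pos, ← pow_mul, mul_comm (2 * m) 2, pow_mul, pow_mul]
    norm_num
    linarith
  · have h := (m + 1).centralBinom_sq_mul_pi_le
    have hc : (m + 1).centralBinom = 2 * (2 * m + 1).choose m := by
      rw [Nat.centralBinom, show 2 * (m + 1) = 2 * m + 1 + 1 by ring, Nat.choose_succ_succ,
        Nat.choose_symm_half]
      ring
    rw [hc, pow_succ (16 : ℝ)] at h
    rw [show (2 * m + 1) / 2 = m by omega, ← pow_mul, show (2 * m + 1) * 2 = 4 * m + 2 by ring,
      pow_add, pow_mul]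
    push_cast at h ⊢
    norm_num
    have : 0 ≤ ((2 * m + 1).choose m : ℝ) ^ 2 * Real.pi := by positivity
    nlinarith

/-- The number of vectors in `𝔽₂ⁿ` with exactly `k` ones. -/
lemma card_filter_card_eq_one_eq_choose (n k : ℕ) :
    (Finset.univ.filter fun x : Fin n → ZMod 2 =>
      (Finset.univ.filter fun i => x i = 1).card = k).card = n.choose k := by
  have h : (Finset.powersetCard k (Finset.univ : Finset (Fin n))).card = n.choose k := by simp
  rw [← h]
  refine Finset.card_nbij' (fun x => Finset.univ.filter fun i => x i = 1)
    (fun s i => if i ∈ s then 1 else 0) ?_ ?_ ?_ ?_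
  · intro x hx
    simpa [Finset.mem_powersetCard] using hx
  · intro s hs
    simpa [Finset.mem_powersetCard] using hs
  · intro x _
    funext i
    have : ∀ a : ZMod 2, (if a = 1 then (1 : ZMod 2) else 0) = a := by decide
    simpa using this (x i)
  · intro s _
    ext i
    simp

/-- At least half of the vectors in `𝔽₂ⁿ` have at most `n / 2` ones. -/
lemma two_pow_le_two_mul_card_filter_two_mul_card_le (n : ℕ) :
    2 ^ n ≤ 2 * (Finset.univ.filter fun x : Fin n → ZMod 2 =>
      2 * (Finset.univ.filter fun i => x i = 1).card ≤ n).card := by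
  have htot := Finset.card_filter_add_card_filter_not (s := Finset.univ)
    (fun x : Fin n → ZMod 2 => 2 * (Finset.univ.filter fun i => x i = 1).card ≤ n)
  rw [Finset.card_univ, Fintype.card_fun, ZMod.card, Fintype.card_fin] at htot
  have hinj : (Finset.univ.filter fun x : Fin n → ZMod 2 =>
      ¬ 2 * (Finset.univ.filter fun i => x i = 1).card ≤ n).card ≤
      (Finset.univ.filter fun x : Fin n → ZMod 2 =>
        2 * (Finset.univ.filter fun i => x i = 1).card ≤ n).card := by
    refine Finset.card_le_card_of_injOn (fun x => x + 1) ?_ (add_left_injective 1).injOn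
    intro x hx
    have hflip : ∀ a : ZMod 2, a + 1 = 1 ↔ ¬ a = 1 := by decide
    have hcompl := Finset.card_filter_add_card_filter_not (s := Finset.univ)
      (fun i => x i = 1)
    rw [Finset.card_univ, Fintype.card_fin] at hcompl
    simp only [Finset.coe_filter, Finset.mem_univ, true_and, Set.mem_ofPred_eq, Pi.add_apply,
      Pi.one_apply, hflip] at hx ⊢
    omega
  omega


/-- Let `η ≥ 0` and let `A` be the set of `x ∈ 𝔽₂ⁿ` with at most
`n/2 - η√(2πn)/2` coordinates equal to `1`. Then `ℙ_G(A) ≥ 1/2 - η - 3.2/√n`. -/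
theorem density_niveau_set_ge {n : ℕ} (η : ℝ) (hη : 0 ≤ η) :
    1 / 2 - η - 3.2 / Real.sqrt n ≤
      (((Finset.univ.filter (fun x : Fin n → ZMod 2 =>
          ((Finset.univ.filter (fun i => x i = 1)).card : ℝ) ≤
            (n : ℝ) / 2 - η * Real.sqrt (2 * Real.pi * n) / 2)).card : ℝ)) / 2 ^ n := by
  rcases Nat.eq_zero_or_pos n with rfl | hn
  · simp
    linarith
  set A := Finset.univ.filter (fun x : Fin n → ZMod 2 =>
    ((Finset.univ.filter (fun i => x i = 1)).card : ℝ) ≤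
      (n : ℝ) / 2 - η * Real.sqrt (2 * Real.pi * n) / 2) with hA
  set s : ℝ := Real.sqrt (2 * Real.pi * n) / 2 with hs
  set C : ℝ := (n.choose (n / 2) : ℝ) with hC
  have hCs : C * s ≤ 2 ^ n := n.choose_half_mul_sqrt_le
  have hcover : (Finset.univ.filter fun x : Fin n → ZMod 2 =>
      2 * (Finset.univ.filter fun i => x i = 1).card ≤ n) ⊆
      A ∪ (Finset.range (⌊η * s⌋₊ + 1)).biUnion fun j =>
        Finset.univ.filter fun x : Fin n → ZMod 2 =>
          (Finset.univ.filter fun i => x i = 1).card = n / 2 - j := by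
    intro x hx
    simp only [Finset.mem_filter, Finset.mem_univ, true_and, Finset.mem_union, hA,
      Finset.mem_biUnion, Finset.mem_range] at hx ⊢
    generalize (Finset.univ.filter fun i => x i = 1).card = w at hx ⊢
    refine or_iff_not_imp_left.2 fun hw => ⟨n / 2 - w, ?_, by omega⟩
    rw [Nat.lt_succ_iff, Nat.le_floor_iff (by positivity), Nat.cast_sub (by omega)]
    have : ((n / 2 : ℕ) : ℝ) ≤ n / 2 := Nat.cast_div_le
    rw [hs]
    linarith
  have hcard := (Finset.card_le_card hcover).trans (Finset.card_union_le _ _)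
  have hslices := Finset.card_biUnion_le_card_mul (Finset.range (⌊η * s⌋₊ + 1))
    (fun j => Finset.univ.filter fun x : Fin n → ZMod 2 =>
      (Finset.univ.filter fun i => x i = 1).card = n / 2 - j) (n.choose (n / 2)) fun j _ => by
    rw [card_filter_card_eq_one_eq_choose]
    exact Nat.choose_le_middle _ n
  rw [Finset.card_range] at hslices
  have hhalf := two_pow_le_two_mul_card_filter_two_mul_card_le n
  have hmain : (2 : ℝ) ^ n ≤ 2 * (A.card + (⌊η * s⌋₊ + 1) * C) := by
    rw [hC]
    exact_mod_cast hhalf.trans (Nat.mul_le_mul_left 2 (hcard.trans (Nat.add_le_add_left hslices _)))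
  have hfloor : (⌊η * s⌋₊ : ℝ) ≤ η * s := Nat.floor_le (by positivity)
  have hsqrt : 0 < Real.sqrt n := Real.sqrt_pos.2 (by exact_mod_cast hn)
  have hsn : Real.sqrt n ≤ s := by
    rw [hs, le_div_iff₀ two_pos]
    refine Real.le_sqrt_of_sq_le ?_
    rw [mul_pow, Real.sq_sqrt (by positivity)]
    nlinarith [Real.pi_gt_three, (Nat.cast_nonneg n : (0 : ℝ) ≤ n)]
  have hC0 : 0 ≤ C := Nat.cast_nonneg _
  have hCn : C ≤ 3.2 / Real.sqrt n * 2 ^ n := by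
    rw [div_mul_eq_mul_div, le_div_iff₀ hsqrt]
    have : C * Real.sqrt n ≤ C * s := by gcongr
    have : (0 : ℝ) < 2 ^ n := by positivity
    linarith
  have hηC : ⌊η * s⌋₊ * C ≤ η * 2 ^ n := by
    calc ⌊η * s⌋₊ * C ≤ η * s * C := by gcongr
      _ = η * (C * s) := by ring
      _ ≤ η * 2 ^ n := by gcongr
  rw [le_div_iff₀ (by positivity)]
  linarith
end

section
/- Suppose that V is a linear subspace of 𝔽₂ⁿ of co-dimension d, where 0 ≤ d ≤ n − 1. Then V contains a vector having at most d coordinates equal to 0 with respect to the standard basis. -/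
/-- Modulo a subspace `V` of `ι → K`, every vector `u` can be corrected to an element of `V` by
changing at most `codim V` coordinates. -/
theorem Submodule.exists_mem_card_ne_le_finrank_quotient {K ι : Type*} [Field K] [DecidableEq K]
    [Fintype ι] (V : Submodule K (ι → K)) (u : ι → K) :
    ∃ v ∈ V, (Finset.univ.filter (fun i => v i ≠ u i)).card ≤
      Module.finrank K ((ι → K) ⧸ V) := by
  classical
  let e : ι → (ι → K) ⧸ V := fun i => V.mkQ (Pi.single i 1)
  obtain ⟨κ, a, ha, hspan, hind⟩ := exists_linearIndependent' K e
  have : Fintype κ := Fintype.ofInjective a ha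
  have hu : V.mkQ u ∈ Submodule.span K (Set.range (e ∘ a)) := by
    rw [hspan, Submodule.mem_span_range_iff_exists_fun]
    refine ⟨u, ?_⟩
    simp only [e, ← map_smul, ← map_sum]
    rw [← pi_eq_sum_univ' u]
  obtain ⟨c, hc⟩ := (Submodule.mem_span_range_iff_exists_fun K).1 hu
  refine ⟨u - ∑ k, c k • Pi.single (a k) 1, ?_, ?_⟩
  · rw [← Submodule.ker_mkQ V, LinearMap.mem_ker, map_sub, ← hc]
    simp [e]
  · calc _ ≤ (Finset.univ.image a).card := Finset.card_le_card fun i hi => by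
          contrapose! hi
          have hne : ∀ k, i ≠ a k := fun k h => hi (h ▸ Finset.mem_image_of_mem a (by simp))
          simp [Finset.sum_apply, hne]
      _ ≤ Fintype.card κ := Finset.card_image_le
      _ ≤ _ := hind.fintype_card_le_finrank

/-- If `V ≤ 𝔽₂ⁿ` is a subspace of co-dimension `d` with `0 ≤ d ≤ n - 1`, then
`V` contains a vector having at most `d` coordinates equal to `0` in the
standard basis. -/
theorem subspace_contains_vector_few_zeros {n : ℕ}
    (V : Submodule (ZMod 2) (Fin n → ZMod 2)) (d : ℕ) (hd : d + 1 ≤ n)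
    (hV : Module.finrank (ZMod 2) V = n - d) :
    ∃ v ∈ V, (Finset.univ.filter (fun i => v i = 0)).card ≤ d := by
  obtain ⟨v, hv, hcard⟩ := V.exists_mem_card_ne_le_finrank_quotient 1
  have hquot := V.finrank_quotient_add_finrank
  rw [Module.finrank_fin_fun] at hquot
  refine ⟨v, hv, ((Finset.card_le_card ?_).trans hcard).trans (by omega)⟩
  exact Finset.monotone_filter_right _ fun i _ hi => by simp [hi]
end
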